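/- Let R₀ > 0 and let B ∈ C¹(𝓑(0,4R₀); ℝ^{d×d}) satisfy: (H) there exists C₀ > 0 with sup_{𝓑(x,r)} |∇B| ≤ (C₀/r) ⨍_{𝓑(x,r)} |B| for every ball 𝓑(x,r) ⊂ 𝓑(0,4R₀); and (H′) sup_{𝓑(x,R₀/2)} |B| > 4 R₀⁻² for every x ∈ 𝓑(0,R₀). Then for every x ∈ 𝓑(0,R₀), |B(x)|^{1/2} + |∇B(x)|^{1/3} ≤ C m(x,B), where C depends only on C₀. -/

import Mathlib

open MeasureTheory Metric Set
open scoped ENNReal NNReal ComplexConjugate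

noncomputable section

/-- `ℝ^d` with the Euclidean norm. -/
abbrev Euc (d : ℕ) := EuclideanSpace ℝ (Fin d)

/-- The auxiliary function `m(·, B)` of Shen: `1/m(x,B) = sup{ r > 0 : sup_{𝓑(x,r)} |B| ≤ r⁻² }`,
formulated in terms of the pointwise norm `nB = |B(·)|`. -/
noncomputable def mfun {d : ℕ} (nB : Euc d → ℝ) (x : Euc d) : ℝ :=
  (sSup {r : ℝ | 0 < r ∧ ∀ y ∈ ball x r, nB y ≤ (r ^ 2)⁻¹})⁻¹

/-- Condition (H): `sup_{𝓑(x,r)} |∇B| ≤ (C₀/r) ⨍_{𝓑(x,r)} |B|` for every ball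
`𝓑(x,r) ⊆ 𝓑(0, 4R₀)`. -/
def CondH {d : ℕ} (C₀ R₀ : ℝ) (B : Euc d → Fin d → Fin d → ℝ) : Prop :=
  ∀ (x : Euc d) (r : ℝ), 0 < r → ball x r ⊆ ball (0 : Euc d) (4 * R₀) →
    ∀ y ∈ ball x r, ‖fderiv ℝ B y‖ ≤ C₀ / r * ⨍ z in ball x r, ‖B z‖

/-- Condition (H′): `sup_{𝓑(x, R₀/2)} |B| > 4 R₀⁻²` for every `x ∈ 𝓑(0, R₀)`. -/
def CondH' {d : ℕ} (R₀ : ℝ) (B : Euc d → Fin d → Fin d → ℝ) : Prop :=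
  ∀ x ∈ ball (0 : Euc d) R₀, ∃ y ∈ ball x (R₀ / 2), 4 / R₀ ^ 2 < ‖B y‖

/-- The set of admissible radii in the definition of `mfun` is nonempty at points of continuity. -/
lemma exists_radius_of_continuousAt {d : ℕ} {f : Euc d → ℝ} {x : Euc d}
    (hf : ContinuousAt f x) : ∃ r : ℝ, 0 < r ∧ ∀ y ∈ ball x r, f y ≤ (r ^ 2)⁻¹ := by
  obtain ⟨δ, hδ, hball⟩ := Metric.eventually_nhds_iff_ball.1
    (hf.eventually (gt_mem_nhds (show f x < |f x| + 1 by linarith [le_abs_self (f x)])))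
  have hM : 1 ≤ |f x| + 1 := by linarith [abs_nonneg (f x)]
  have hM0 : 0 < |f x| + 1 := by linarith
  have hr : 0 < min δ (|f x| + 1)⁻¹ := lt_min hδ (inv_pos.2 hM0)
  refine ⟨min δ (|f x| + 1)⁻¹, hr, fun y hy => ?_⟩
  refine (hball y (ball_subset_ball (min_le_left _ _) hy)).le.trans ?_
  rw [le_inv_comm₀ hM0 (by positivity)]
  calc (min δ (|f x| + 1)⁻¹) ^ 2 ≤ (|f x| + 1)⁻¹ ^ 2 := by
        gcongr
        exact min_le_right _ _
    _ ≤ (|f x| + 1)⁻¹ := pow_le_of_le_one (by positivity) (inv_le_one_of_one_le₀ hM) two_ne_zero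

/-- The average over a ball of a function bounded in norm by `K` is at most `K`. -/
lemma setAverage_ball_le {d : ℕ} {f : Euc d → ℝ} {x : Euc d} {r K : ℝ} (hr : 0 < r)
    (hf : ∀ y ∈ ball x r, ‖f y‖ ≤ K) : ⨍ z in ball x r, f z ≤ K := by
  have hpos : 0 < volume.real (ball x r) :=
    ENNReal.toReal_pos (measure_ball_pos _ _ hr).ne' measure_ball_lt_top.ne
  have h : ∫ z in ball x r, f z ≤ K * volume.real (ball x r) :=
    (le_abs_self _).trans (norm_setIntegral_le_of_norm_le_const measure_ball_lt_top hf)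
  rw [setAverage_eq, smul_eq_mul, inv_mul_le_iff₀ hpos, mul_comm]
  exact h

/-- If `B ∈ C¹(𝓑(0,4R₀); ℝ^{d×d})` satisfies (H) and (H′), then
`|B(x)|^{1/2} + |∇B(x)|^{1/3} ≤ C m(x,B)` for every `x ∈ 𝓑(0,R₀)`, with `C` depending
only on `C₀` (and the dimension). -/
theorem stmt_8 {d : ℕ} (C₀ : ℝ) (hC₀ : 0 < C₀) :
    ∃ C > (0 : ℝ), ∀ R₀ : ℝ, 0 < R₀ →
      ∀ B : Euc d → Fin d → Fin d → ℝ, ContDiffOn ℝ 1 B (ball (0 : Euc d) (4 * R₀)) →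
        CondH C₀ R₀ B → CondH' R₀ B →
        ∀ x ∈ ball (0 : Euc d) R₀,
          ‖B x‖ ^ (1 / 2 : ℝ) + ‖fderiv ℝ B x‖ ^ (1 / 3 : ℝ) ≤
            C * mfun (fun y => ‖B y‖) x := by
  refine ⟨2 * (1 + C₀ ^ (1 / 3 : ℝ)), by positivity, fun R₀ hR₀ B hB hH hH' x hx => ?_⟩
  have hxR : dist x 0 < R₀ := hx
  have hcont : ContinuousAt (fun y => ‖B y‖) x :=
    (hB.continuousOn.continuousAt
      (isOpen_ball.mem_nhds (ball_subset_ball (by linarith) hx))).norm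
  set S : Set ℝ := {r : ℝ | 0 < r ∧ ∀ y ∈ ball x r, ‖B y‖ ≤ (r ^ 2)⁻¹} with hS
  have hle : ∀ r ∈ S, r ≤ R₀ / 2 := by
    rintro r ⟨hr, hrB⟩
    by_contra! hlt
    obtain ⟨y, hy, hBy⟩ := hH' x hx
    refine (hBy.trans_le (hrB y (ball_subset_ball hlt.le hy))).not_ge ?_
    calc (r ^ 2)⁻¹ ≤ ((R₀ / 2) ^ 2)⁻¹ := by gcongr
      _ = 4 / R₀ ^ 2 := by field_simp; norm_num
  obtain ⟨r₀, hr₀⟩ : S.Nonempty := exists_radius_of_continuousAt hcont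
  have hpos : 0 < sSup S := hr₀.1.trans_le (le_csSup ⟨R₀ / 2, hle⟩ hr₀)
  obtain ⟨r, hrS, hlt⟩ := exists_lt_of_lt_csSup ⟨r₀, hr₀⟩ (half_lt_self hpos)
  obtain ⟨hr, hrB⟩ := hrS
  have hxr : x ∈ ball x r := mem_ball_self hr
  have hsub : ball x r ⊆ ball (0 : Euc d) (4 * R₀) :=
    ball_subset_ball' (by linarith [hle r ⟨hr, hrB⟩])
  have hgrad : ‖fderiv ℝ B x‖ ≤ C₀ * r⁻¹ ^ 3 := by
    calc ‖fderiv ℝ B x‖ ≤ C₀ / r * ⨍ z in ball x r, ‖B z‖ := hH x r hr hsub x hxr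
      _ ≤ C₀ / r * (r ^ 2)⁻¹ := by
        gcongr
        exact setAverage_ball_le hr fun y hy => by simpa using hrB y hy
      _ = C₀ * r⁻¹ ^ 3 := by field_simp
  have h₁ : ‖B x‖ ^ (1 / 2 : ℝ) ≤ r⁻¹ := by
    calc ‖B x‖ ^ (1 / 2 : ℝ) ≤ (r⁻¹ ^ 2) ^ (1 / 2 : ℝ) := by
          gcongr
          simpa using hrB x hxr
      _ = r⁻¹ := by
        rw [one_div]
        exact Real.pow_rpow_inv_natCast (by positivity) two_ne_zero
  have h₂ : ‖fderiv ℝ B x‖ ^ (1 / 3 : ℝ) ≤ C₀ ^ (1 / 3 : ℝ) * r⁻¹ := by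
    calc ‖fderiv ℝ B x‖ ^ (1 / 3 : ℝ) ≤ (C₀ * r⁻¹ ^ 3) ^ (1 / 3 : ℝ) := by gcongr
      _ = C₀ ^ (1 / 3 : ℝ) * r⁻¹ := by
        rw [Real.mul_rpow hC₀.le (by positivity)]
        congr 1
        rw [one_div]
        exact Real.pow_rpow_inv_natCast (by positivity) three_ne_zero
  have hinv : r⁻¹ ≤ 2 * (sSup S)⁻¹ := by
    calc r⁻¹ ≤ (sSup S / 2)⁻¹ := by gcongr
      _ = 2 * (sSup S)⁻¹ := by rw [inv_div, div_eq_mul_inv]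
  calc ‖B x‖ ^ (1 / 2 : ℝ) + ‖fderiv ℝ B x‖ ^ (1 / 3 : ℝ)
      ≤ (1 + C₀ ^ (1 / 3 : ℝ)) * r⁻¹ := by linarith
    _ ≤ (1 + C₀ ^ (1 / 3 : ℝ)) * (2 * (sSup S)⁻¹) := by gcongr
    _ = 2 * (1 + C₀ ^ (1 / 3 : ℝ)) * mfun (fun y => ‖B y‖) x := by
      rw [mfun, ← hS]
      ring
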